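/- Fix τ > 0 and x, k ∈ ℝ, and let ι : (max(x − k, 0), ∞) → (0, ∞) denote the implied Bachelier volatility map, i.e. the inverse of the strictly increasing bijection σ ↦ Bac(τ, x, k, σ) from (0, ∞) onto (max(x − k, 0), ∞). Then ι is differentiable on its domain, with ι′(v) = 1 / ( φ(d(x, k, ι(v), τ))·√τ ) for every v in (max(x − k, 0), ∞); in the at-the-money case k = x this derivative is constant in v and equals √(2π)/√τ. -/

import Mathlib

open MeasureTheory Filter Set

/-- Standard normal density `φ(z) = e^{-z²/2}/√(2π)`. -/
noncomputable def stdGaussPdf (z : ℝ) : ℝ := Real.exp (-(z ^ 2) / 2) / Real.sqrt (2 * Real.pi)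

/-- Standard normal cumulative distribution function `Φ(z) = ∫_{-∞}^z φ(u) du`. -/
noncomputable def stdGaussCdf (z : ℝ) : ℝ := ∫ u in Set.Iic z, stdGaussPdf u

/-- `d(x, k, σ, τ) = (x − k)/(σ√τ)`. -/
noncomputable def dBac (x k σ τ : ℝ) : ℝ := (x - k) / (σ * Real.sqrt τ)

/-- Bachelier price `Bac(τ, x, k, σ) = (x − k)·Φ(d) + φ(d)·σ·√τ`. -/
noncomputable def Bac (τ x k σ : ℝ) : ℝ :=
  (x - k) * stdGaussCdf (dBac x k σ τ) + stdGaussPdf (dBac x k σ τ) * σ * Real.sqrt τ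

lemma pdf_cont : Continuous stdGaussPdf := by
  unfold stdGaussPdf; fun_prop

lemma pdf_pos (z : ℝ) : 0 < stdGaussPdf z := by
  unfold stdGaussPdf; positivity

lemma pdf_int : Integrable stdGaussPdf := by
  have h := (integrable_exp_neg_mul_sq (b := 1/2) (by norm_num)).div_const (Real.sqrt (2 * Real.pi))
  refine h.congr (Eventually.of_forall fun z => ?_)
  simp only [stdGaussPdf]
  congr 2
  ring

lemma cdf_deriv (z : ℝ) : HasDerivAt stdGaussCdf (stdGaussPdf z) z := by
  have h : stdGaussCdf = fun z => stdGaussCdf 0 + ∫ u in (0:ℝ)..z, stdGaussPdf u := by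
    funext z
    have := intervalIntegral.integral_Iic_sub_Iic (a := 0) (b := z) (f := stdGaussPdf)
      (μ := volume) pdf_int.integrableOn pdf_int.integrableOn
    unfold stdGaussCdf
    linarith
  rw [h]
  exact (intervalIntegral.integral_hasDerivAt_right (pdf_cont.intervalIntegrable _ _)
    (pdf_cont.stronglyMeasurableAtFilter _ _) pdf_cont.continuousAt).const_add _

lemma pdf_deriv (z : ℝ) : HasDerivAt stdGaussPdf (-z * stdGaussPdf z) z := by
  have h1 : HasDerivAt (fun z : ℝ => -(z ^ 2) / 2) (-z) z := by
    have := ((hasDerivAt_pow 2 z).neg).div_const 2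
    refine this.congr_deriv ?_
    simp
    ring
  have h := h1.exp.div_const (Real.sqrt (2 * Real.pi))
  refine h.congr_deriv ?_
  unfold stdGaussPdf
  ring

lemma bac_deriv (τ x k : ℝ) (hτ : 0 < τ) (s : ℝ) (hs : 0 < s) :
    HasDerivAt (Bac τ x k) (stdGaussPdf (dBac x k s τ) * Real.sqrt τ) s := by
  have ht : 0 < Real.sqrt τ := Real.sqrt_pos.mpr hτ
  have hd : HasDerivAt (fun s => dBac x k s τ) (-(dBac x k s τ) / s) s := by
    have h := (hasDerivAt_const s (x - k)).div ((hasDerivAt_id s).mul_const (Real.sqrt τ))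
      (by simp; exact ⟨hs.ne', ht.ne'⟩)
    refine h.congr_deriv ?_
    simp only [dBac, id]
    field_simp
    ring
  have h1 := ((cdf_deriv _).comp s hd).const_mul (x - k)
  have h2 := ((((pdf_deriv _).comp s hd).mul (hasDerivAt_id s)).mul_const (Real.sqrt τ))
  refine (h1.add h2).congr_deriv ?_
  have hx : x - k = dBac x k s τ * (s * Real.sqrt τ) := by
    unfold dBac; field_simp
  rw [hx]
  simp only [Function.comp, id]
  field_simp
  ring

/-- Fix τ > 0 and x, k ∈ ℝ, and let ι be the implied Bachelier
volatility map on `(max (x − k) 0, ∞)`, i.e. the inverse of the strictly increasing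
bijection `σ ↦ Bac(τ, x, k, σ)` from (0, ∞) onto `(max (x − k) 0, ∞)`: for each v
in this interval, `ι(v) > 0` and `Bac(τ, x, k, ι(v)) = v`. Then ι is differentiable
on its domain with `ι′(v) = 1/(φ(d(x, k, ι(v), τ))·√τ)`; in the at-the-money case
k = x this derivative equals `√(2π)/√τ` for every v in the domain. -/
theorem implied_vol_derivative (τ x k : ℝ) (hτ : 0 < τ)
    (ι : ℝ → ℝ)
    (hι : ∀ v ∈ Set.Ioi (max (x - k) 0), 0 < ι v ∧ Bac τ x k (ι v) = v) :
    ∀ v ∈ Set.Ioi (max (x - k) 0),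
      HasDerivAt ι (1 / (stdGaussPdf (dBac x k (ι v) τ) * Real.sqrt τ)) v ∧
      (k = x → 1 / (stdGaussPdf (dBac x k (ι v) τ) * Real.sqrt τ)
        = Real.sqrt (2 * Real.pi) / Real.sqrt τ) := by
  intro v hv
  have ht : 0 < Real.sqrt τ := Real.sqrt_pos.mpr hτ
  constructor
  · have hmono : StrictMonoOn (Bac τ x k) (Ioi 0) := by
      apply strictMonoOn_of_deriv_pos (convex_Ioi 0)
      · exact fun s hs => (bac_deriv τ x k hτ s hs).continuousAt.continuousWithinAt
      · intro s hs
        rw [interior_Ioi] at hs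
        rw [(bac_deriv τ x k hτ s hs).deriv]
        exact mul_pos (pdf_pos _) ht
    have hnhds : ∀ᶠ w in nhds v, w ∈ Ioi (max (x - k) 0) := Ioi_mem_nhds hv
    obtain ⟨h0, hb⟩ := hι v hv
    have hcont : ContinuousAt ι v := by
      refine tendsto_order.2 ⟨fun a ha => ?_, fun b hb' => ?_⟩
      · by_cases ha0 : 0 < a
        · have : Bac τ x k a < v := by
            rw [← hb]; exact hmono ha0 h0 ha
          filter_upwards [hnhds, Ioi_mem_nhds this] with w hw hw'
          obtain ⟨h1, h2⟩ := hι w hw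
          rw [← hmono.lt_iff_lt (mem_Ioi.2 ha0) (mem_Ioi.2 h1), h2]
          exact hw'
        · filter_upwards [hnhds] with w hw
          linarith [(hι w hw).1]
      · have hb0 : 0 < b := h0.trans hb'
        have : v < Bac τ x k b := by
          conv_lhs => rw [← hb]
          exact hmono h0 hb0 hb'
        filter_upwards [hnhds, Iio_mem_nhds this] with w hw hw'
        obtain ⟨h1, h2⟩ := hι w hw
        rw [← hmono.lt_iff_lt (mem_Ioi.2 h1) (mem_Ioi.2 hb0), h2]
        exact hw'
    rw [one_div]
    exact HasDerivAt.of_local_left_inverse hcont (bac_deriv τ x k hτ _ h0)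
      (mul_pos (pdf_pos _) ht).ne' (hnhds.mono fun w hw => (hι w hw).2)
  · rintro rfl
    have : 0 < Real.sqrt (2 * Real.pi) := by positivity
    simp [dBac, stdGaussPdf]
    field_simp
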